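/- Let α > 0 be a noninteger real number, n = ⌊α⌋ + 1, a ∈ ℤ, f : ℤ → ℝ, and t ∈ ℤ with t ≥ a + 1. Then (∇_a^{−α}(^C∇_a^{α} f))(t) = f(t) − Σ_{k=0}^{n−1} [Γ(t−a+k)/(Γ(t−a)·k!)]·(∇^k f)(a). In particular, if 0 < α < 1 then (∇_a^{−α}(^C∇_a^{α} f))(t) = f(t) − f(a). -/

import Mathlib

/-- Backward difference operator: `(∇ f)(t) = f t − f (t−1)`. -/
def nablaOp (f : ℤ → ℝ) : ℤ → ℝ := fun t => f t - f (t - 1)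

/-- Forward difference operator: `(Δ f)(t) = f (t+1) − f t`. -/
def deltaOp (f : ℤ → ℝ) : ℤ → ℝ := fun t => f (t + 1) - f t

/-- The operator `−Δ`. -/
def negDeltaOp (f : ℤ → ℝ) : ℤ → ℝ := fun t => -(f (t + 1) - f t)

/-- Nabla left fractional sum of order `α` starting at `a`:
`(∇_a^{-α} f)(t) = (1/Γ(α)) Σ_{s=a+1}^{t} [Γ(t−s+α)/Γ(t−s+1)] f(s)`. -/
noncomputable def nablaLeftSum (a : ℤ) (α : ℝ) (f : ℤ → ℝ) : ℤ → ℝ := fun t =>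
  (1 / Real.Gamma α) * ∑ s ∈ Finset.Icc (a + 1) t,
    (Real.Gamma ((t : ℝ) - (s : ℝ) + α) / Real.Gamma ((t : ℝ) - (s : ℝ) + 1)) * f s

/-- Nabla right fractional sum of order `α` ending at `b`:
`(_b∇^{-α} f)(t) = (1/Γ(α)) Σ_{s=t}^{b−1} [Γ(s−t+α)/Γ(s−t+1)] f(s)`. -/
noncomputable def nablaRightSum (b : ℤ) (α : ℝ) (f : ℤ → ℝ) : ℤ → ℝ := fun t =>
  (1 / Real.Gamma α) * ∑ s ∈ Finset.Icc t (b - 1),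
    (Real.Gamma ((s : ℝ) - (t : ℝ) + α) / Real.Gamma ((s : ℝ) - (t : ℝ) + 1)) * f s

open PowerSeries in
/-- The power series `(1 - X) ^ (-r)`, the generating function of the kernel of the nabla
fractional sum of order `r`. -/
noncomputable def nablaKernel (r : ℝ) : PowerSeries ℝ :=
  rescale (-1 : ℝ) (binomialSeries ℝ (-r))

theorem nablaKernel_add (r s : ℝ) : nablaKernel (r + s) = nablaKernel r * nablaKernel s := by
  rw [nablaKernel, neg_add, PowerSeries.binomialSeries_add, map_mul]
  rfl

theorem nablaKernel_zero : nablaKernel 0 = 1 := by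
  simp [nablaKernel]

theorem nablaKernel_neg_one : nablaKernel (-1) = 1 - PowerSeries.X := by
  have h := PowerSeries.binomialSeries_nat (R := ℝ) (A := ℝ) 1
  rw [Nat.cast_one, pow_one] at h
  rw [nablaKernel, neg_neg, h, map_add, map_one, PowerSeries.rescale_neg_one_X, sub_eq_add_neg]

theorem nablaKernel_add_one_mul (r : ℝ) :
    nablaKernel (r + 1) * (1 - PowerSeries.X) = nablaKernel r := by
  rw [← nablaKernel_neg_one, ← nablaKernel_add, add_neg_cancel_right]

theorem Real.Gamma_add_natCast_eq_ascPochhammer_mul {r : ℝ} (hr : 0 < r) (k : ℕ) :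
    Real.Gamma (k + r) = (ascPochhammer ℝ k).eval r * Real.Gamma r := by
  induction k with
  | zero => simp
  | succ k ih =>
    rw [Nat.cast_succ, add_right_comm, Real.Gamma_add_one (by positivity), ih,
      ascPochhammer_succ_eval]
    ring

theorem coeff_nablaKernel {r : ℝ} (hr : 0 < r) (k : ℕ) :
    PowerSeries.coeff k (nablaKernel r) =
      Real.Gamma (k + r) / (Real.Gamma r * Real.Gamma (k + 1)) := by
  have hΓ : Real.Gamma r ≠ 0 := (Real.Gamma_pos_of_pos hr).ne'
  have hk : (k.factorial : ℝ) ≠ 0 := by exact_mod_cast k.factorial_ne_zero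
  have h := Ring.factorial_nsmul_multichoose_eq_ascPochhammer r k
  rw [Polynomial.ascPochhammer_smeval_eq_eval, nsmul_eq_mul] at h
  have hc : PowerSeries.coeff k (nablaKernel r) = Ring.multichoose r k := by
    rw [nablaKernel, PowerSeries.coeff_rescale, PowerSeries.binomialSeries_coeff,
      Ring.choose_neg', smul_eq_mul, mul_one, Units.smul_def, zsmul_eq_mul,
      Int.cast_negOnePow_natCast, ← mul_assoc, ← mul_pow]
    simp
  rw [hc, Real.Gamma_nat_eq_factorial, Real.Gamma_add_natCast_eq_ascPochhammer_mul hr, ← h]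
  field_simp

/-- The generating function of the values `f (a + 1), f (a + 2), …`. -/
noncomputable def genSeries (a : ℤ) (f : ℤ → ℝ) : PowerSeries ℝ :=
  PowerSeries.mk fun j => f (a + 1 + j)

theorem genSeries_nablaLeftSum (a : ℤ) {r : ℝ} (hr : 0 < r) (f : ℤ → ℝ) :
    genSeries a (nablaLeftSum a r f) = nablaKernel r * genSeries a f := by
  ext m
  rw [genSeries, PowerSeries.coeff_mk, mul_comm, PowerSeries.coeff_mul,
    Finset.Nat.sum_antidiagonal_eq_sum_range_succ_mk, nablaLeftSum, Finset.mul_sum]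
  symm
  refine Finset.sum_bij (fun j _ => a + 1 + (j : ℤ)) ?_ ?_ ?_ ?_
  · intro j hj
    simp only [Finset.mem_range, Finset.mem_Icc] at hj ⊢
    lia
  · intro i _ j _ h
    lia
  · intro s hs
    simp only [Finset.mem_Icc] at hs
    exact ⟨(s - (a + 1)).toNat, by simp only [Finset.mem_range]; lia, by lia⟩
  · intro j hj
    have hjm : j ≤ m := Nat.lt_succ_iff.mp (Finset.mem_range.mp hj)
    have hsub : ((a + 1 + (m : ℤ) : ℤ) : ℝ) - ((a + 1 + (j : ℤ) : ℤ) : ℝ) = ((m - j : ℕ) : ℝ) := by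
      push_cast [hjm]
      ring
    rw [genSeries, PowerSeries.coeff_mk, coeff_nablaKernel hr, hsub, div_mul_eq_div_div]
    ring

theorem genSeries_nablaOp (a : ℤ) (f : ℤ → ℝ) :
    genSeries a (nablaOp f) =
      (1 - PowerSeries.X) * genSeries a f - PowerSeries.C (f a) := by
  ext m
  rw [sub_mul, one_mul]
  cases m with
  | zero => simp [genSeries, nablaOp]
  | succ m =>
    simp only [genSeries, nablaOp, map_sub, PowerSeries.coeff_mk, PowerSeries.coeff_succ_X_mul,
      PowerSeries.coeff_C, Nat.succ_ne_zero, if_false, sub_zero]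
    congr 2
    push_cast
    ring

theorem nablaKernel_mul_genSeries_iterate_nablaOp (a : ℤ) (f : ℤ → ℝ) (n : ℕ) :
    nablaKernel n * genSeries a (nablaOp^[n] f) =
      genSeries a f -
        ∑ k ∈ Finset.range n, nablaKernel (k + 1) * PowerSeries.C ((nablaOp^[k] f) a) := by
  induction n with
  | zero => simp [nablaKernel_zero]
  | succ n ih =>
    rw [Function.iterate_succ_apply', genSeries_nablaOp, Finset.sum_range_succ, Nat.cast_succ,
      mul_sub, ← mul_assoc, nablaKernel_add_one_mul, ih, sub_sub]

theorem stmt11 (α : ℝ) (hα : 0 < α) (hαni : ∀ m : ℤ, α ≠ (m : ℝ)) (n : ℕ)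
    (hn : (n : ℤ) = ⌊α⌋ + 1) (a : ℤ) (f : ℤ → ℝ) (t : ℤ) (ht : a + 1 ≤ t) :
    nablaLeftSum a α (nablaLeftSum a ((n : ℝ) - α) (nablaOp^[n] f)) t =
      f t - ∑ k ∈ Finset.range n,
          (Real.Gamma ((t : ℝ) - (a : ℝ) + (k : ℝ)) /
            (Real.Gamma ((t : ℝ) - (a : ℝ)) * (Nat.factorial k : ℝ))) * (nablaOp^[k] f) a ∧
      (α < 1 →
        nablaLeftSum a α (nablaLeftSum a ((n : ℝ) - α) (nablaOp^[n] f)) t = f t - f a) := by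
  have hnα : 0 < (n : ℝ) - α := by
    have h : (n : ℝ) = ⌊α⌋ + 1 := by exact_mod_cast hn
    linarith [Int.lt_floor_add_one α]
  have main : nablaLeftSum a α (nablaLeftSum a ((n : ℝ) - α) (nablaOp^[n] f)) t =
      f t - ∑ k ∈ Finset.range n,
          (Real.Gamma ((t : ℝ) - (a : ℝ) + (k : ℝ)) /
            (Real.Gamma ((t : ℝ) - (a : ℝ)) * (Nat.factorial k : ℝ))) * (nablaOp^[k] f) a := by
    obtain ⟨m, rfl⟩ := Int.le.dest ht
    have h := congrArg (PowerSeries.coeff m) (nablaKernel_mul_genSeries_iterate_nablaOp a f n)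
    rw [show (n : ℝ) = α + (n - α) by ring, nablaKernel_add, mul_assoc,
      ← genSeries_nablaLeftSum a hnα, ← genSeries_nablaLeftSum a hα, map_sub, map_sum,
      genSeries, genSeries, PowerSeries.coeff_mk, PowerSeries.coeff_mk] at h
    rw [h]
    congr 1
    refine Finset.sum_congr rfl fun k _ => ?_
    have hsub : ((a + 1 + (m : ℤ) : ℤ) : ℝ) - a = m + 1 := by
      push_cast
      ring
    rw [PowerSeries.coeff_mul_C, coeff_nablaKernel (by positivity), hsub,
      Real.Gamma_nat_eq_factorial k, mul_comm (k.factorial : ℝ),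
      show (m : ℝ) + (k + 1) = m + 1 + k by ring]
  refine ⟨main, fun hα1 => ?_⟩
  have hn1 : n = 1 := by
    have : ⌊α⌋ = 0 := Int.floor_eq_zero_iff.mpr ⟨hα.le, hα1⟩
    lia
  have hΓ : Real.Gamma ((t : ℝ) - a) ≠ 0 := by
    have : (a : ℝ) + 1 ≤ t := by exact_mod_cast ht
    exact (Real.Gamma_pos_of_pos (by linarith)).ne'
  rw [main, hn1]
  simp [hΓ]
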